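/- Let Φ : [0,T] × ℝ^N → ℝ^N be such that for every x ∈ ℝ^N the map t ↦ Φ_t(x) is the solution of the N-dimensional shell model on [0,T] with initial condition x. Then for every r > 0 and every t ∈ [0,T], the pushforward of μ_r^N under the map x ↦ Φ_t(x) equals μ_r^N; that is, the product Gaussian measure μ_r^N is invariant for the N-dimensional shell model. -/

import Mathlib

open MeasureTheory ProbabilityTheory

/-- Coefficients of the N-dimensional shell model: `k n = λ ^ n` for `1 < n < N`,
and `k 0 = k 1 = k N = k (N+1) = 0`. -/
noncomputable def shellK (lam : ℝ) (N : ℕ) (n : ℕ) : ℝ :=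
  if 1 < n ∧ n < N then lam ^ n else 0

/-- A solution of the `N`-dimensional shell model on `[0,T]`, with the convention
`X_0 ≡ 0`, `X_{N+1} ≡ 0`. -/
def IsShellSolution (lam : ℝ) (N : ℕ) (T : ℝ) (X : ℝ → ℕ → ℝ) : Prop :=
  (∀ t, X t 0 = 0) ∧ (∀ t, X t (N + 1) = 0) ∧
  ∀ n, 1 ≤ n → n ≤ N → ∀ t ∈ Set.Icc (0 : ℝ) T,
    HasDerivWithinAt (fun u => X u n)
      (shellK lam N n * (X t (n - 1)) ^ 2
        - shellK lam N (n + 1) * X t n * X t (n + 1)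
        - shellK lam N n * (X t (n + 1)) ^ 2
        + shellK lam N (n - 1) * X t (n - 1) * X t n)
      (Set.Icc (0 : ℝ) T) t

/-- View a vector `v ∈ ℝ^N` as a sequence: component `n` is `v (n-1)` for `1 ≤ n ≤ N`,
and `0` otherwise (the conventional components). -/
def extendFin (N : ℕ) (v : Fin N → ℝ) : ℕ → ℝ :=
  fun n => if h : 1 ≤ n ∧ n ≤ N then v ⟨n - 1, by omega⟩ else 0

section Helpers

open MvPolynomial Filter Topology

/-- `IsPolyBound d M p`: the polynomial `p` has degree at most `d` and can be written with
coefficients whose absolute values sum to at most `M`. -/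
inductive IsPolyBound {ι : Type*} : ℕ → ℝ → MvPolynomial ι ℝ → Prop
  | const (c : ℝ) : IsPolyBound 0 |c| (C c)
  | X_mul (i : ι) {d : ℕ} {M : ℝ} {p : MvPolynomial ι ℝ} :
      IsPolyBound d M p → IsPolyBound (d + 1) M (X i * p)
  | add {d : ℕ} {M M' : ℝ} {p q : MvPolynomial ι ℝ} :
      IsPolyBound d M p → IsPolyBound d M' q → IsPolyBound d (M + M') (p + q)
  | mono {d d' : ℕ} {M M' : ℝ} {p : MvPolynomial ι ℝ} :
      IsPolyBound d M p → d ≤ d' → M ≤ M' → IsPolyBound d' M' p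

namespace IsPolyBound

variable {ι : Type*} {d d' : ℕ} {M M' : ℝ} {p q : MvPolynomial ι ℝ}

theorem nonneg (h : IsPolyBound d M p) : 0 ≤ M := by
  induction h with
  | const c => exact abs_nonneg c
  | X_mul i _ ih => exact ih
  | add _ _ ih₁ ih₂ => exact add_nonneg ih₁ ih₂
  | mono _ _ hM ih => exact ih.trans hM

theorem C_mul (c : ℝ) (h : IsPolyBound d M p) : IsPolyBound d (|c| * M) (C c * p) := by
  induction h with
  | const a => rw [← abs_mul, ← map_mul]; exact const _
  | X_mul i _ ih => rw [mul_left_comm]; exact X_mul i ih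
  | add _ _ ih₁ ih₂ => rw [mul_add, mul_add]; exact add ih₁ ih₂
  | mono _ hd hM ih => exact mono ih hd (mul_le_mul_of_nonneg_left hM (abs_nonneg c))

theorem mul (hp : IsPolyBound d M p) (hq : IsPolyBound d' M' q) :
    IsPolyBound (d + d') (M * M') (p * q) := by
  induction hp with
  | const c => rw [zero_add]; exact C_mul c hq
  | X_mul i _ ih => rw [mul_assoc, add_right_comm]; exact X_mul i ih
  | add _ _ ih₁ ih₂ => rw [add_mul, add_mul]; exact add ih₁ ih₂
  | mono _ hd hM ih =>
    exact mono ih (by omega) (mul_le_mul_of_nonneg_right hM hq.nonneg)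

theorem abs_eval_le {R : ℝ} (hR : 1 ≤ R) {x : ι → ℝ} (hx : ∀ i, |x i| ≤ R)
    (h : IsPolyBound d M p) : |eval x p| ≤ M * R ^ d := by
  have hR0 : 0 ≤ R := zero_le_one.trans hR
  induction h with
  | const c => simp
  | @X_mul i d M p _ ih =>
    rw [map_mul, eval_X, abs_mul, pow_succ', mul_left_comm]
    exact mul_le_mul (hx i) ih (abs_nonneg _) hR0
  | add _ _ ih₁ ih₂ =>
    rw [map_add, add_mul]
    exact (abs_add_le _ _).trans (add_le_add ih₁ ih₂)
  | mono h hd hM ih =>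
    exact ih.trans (mul_le_mul hM (pow_le_pow_right₀ hR hd) (by positivity)
      (h.nonneg.trans hM))

theorem of_X (i : ι) : IsPolyBound 1 1 (X i : MvPolynomial ι ℝ) := by
  simpa using X_mul i (const (ι := ι) 1)

protected theorem zero (d : ℕ) : IsPolyBound d 0 (0 : MvPolynomial ι ℝ) := by
  simpa using mono (const (ι := ι) 0) (Nat.zero_le d) (abs_zero (α := ℝ)).le

protected theorem neg (h : IsPolyBound d M p) : IsPolyBound d M (-p) := by
  simpa using C_mul (-1) h

protected theorem sub (hp : IsPolyBound d M p) (hq : IsPolyBound d M' q) :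
    IsPolyBound d (M + M') (p - q) := by
  rw [sub_eq_add_neg]; exact add hp hq.neg

theorem exists_bound (p : MvPolynomial ι ℝ) : ∃ d M, IsPolyBound d M p := by
  induction p using MvPolynomial.induction_on with
  | C c => exact ⟨_, _, const c⟩
  | add p q hp hq =>
    obtain ⟨d, M, hp⟩ := hp
    obtain ⟨d', M', hq⟩ := hq
    exact ⟨max d d', _, add (mono hp (le_max_left _ _) le_rfl) (mono hq (le_max_right _ _) le_rfl)⟩
  | mul_X p i hp =>
    obtain ⟨d, M, hp⟩ := hp
    exact ⟨_, _, mul hp (of_X i)⟩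

variable {V : ι → MvPolynomial ι ℝ} {K : ℝ}

theorem mkDerivation (hV : ∀ i, IsPolyBound 2 K (V i)) (hK : 0 ≤ K) (h : IsPolyBound d M p) :
    IsPolyBound (d + 1) (K * (d + 1) * M) (MvPolynomial.mkDerivation ℝ V p) := by
  induction h with
  | const c =>
    rw [derivation_C]
    exact mono (IsPolyBound.zero _) le_rfl (by positivity)
  | @X_mul i d M p h ih =>
    rw [Derivation.leibniz, mkDerivation_X, smul_eq_mul, smul_eq_mul]
    have h' := mul h (hV i)
    refine mono (add (X_mul i ih) h') le_rfl (le_of_eq ?_)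
    push_cast; ring
  | add _ _ ih₁ ih₂ => rw [map_add, mul_add]; exact add ih₁ ih₂
  | @mono d d' M M' p h hd hM ih =>
    refine mono ih (by omega) ?_
    have := h.nonneg
    have hd' : (d : ℝ) ≤ d' := by exact_mod_cast hd
    gcongr

theorem mkDerivation_iterate (hV : ∀ i, IsPolyBound 2 K (V i)) (hK : 0 ≤ K)
    (h : IsPolyBound d M p) (k : ℕ) :
    IsPolyBound (d + k) (K ^ k * (d + 1).ascFactorial k * M)
      ((MvPolynomial.mkDerivation ℝ V)^[k] p) := by
  induction k with
  | zero => simpa using h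
  | succ k ih =>
    rw [Function.iterate_succ_apply']
    refine mono (mkDerivation hV hK ih) (by omega) (le_of_eq ?_)
    rw [Nat.ascFactorial_succ]
    push_cast; ring

/-- Along points bounded by `R`, the iterated derivatives of `p` grow like `k! * (2 * K * R) ^ k`. -/
theorem exists_abs_eval_iterate_le (hV : ∀ i, IsPolyBound 2 K (V i)) (hK : 0 ≤ K) {R : ℝ}
    (hR : 1 ≤ R) (p : MvPolynomial ι ℝ) :
    ∃ B, 0 ≤ B ∧ ∀ k, ∀ x : ι → ℝ, (∀ i, |x i| ≤ R) →
      |eval x ((MvPolynomial.mkDerivation ℝ V)^[k] p)| ≤ B * k.factorial * (2 * K * R) ^ k := by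
  obtain ⟨d, M, h⟩ := exists_bound p
  have hM := h.nonneg
  have hR0 : 0 ≤ R := zero_le_one.trans hR
  refine ⟨M * (2 * R) ^ d, by positivity, fun k x hx => ?_⟩
  refine (abs_eval_le hR hx (mkDerivation_iterate hV hK h k)).trans ?_
  have hc : ((d + k).choose k : ℝ) ≤ 2 ^ (d + k) := by exact_mod_cast Nat.choose_le_two_pow _ _
  rw [Nat.ascFactorial_eq_factorial_mul_choose]
  push_cast
  calc K ^ k * (k.factorial * ((d + k).choose k : ℝ)) * M * R ^ (d + k)
      ≤ K ^ k * (k.factorial * 2 ^ (d + k)) * M * R ^ (d + k) := by gcongr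
    _ = _ := by rw [mul_pow, mul_pow, mul_pow, pow_add, pow_add]; ring

end IsPolyBound

section Flow

variable {ι : Type*} {V : ι → MvPolynomial ι ℝ}

theorem hasDerivWithinAt_eval {X : ℝ → ι → ℝ} {s : Set ℝ} {t : ℝ}
    (hX : ∀ i, HasDerivWithinAt (fun u => X u i) (eval (X t) (V i)) s t) (p : MvPolynomial ι ℝ) :
    HasDerivWithinAt (fun u => eval (X u) p) (eval (X t) (mkDerivation ℝ V p)) s t := by
  induction p using MvPolynomial.induction_on with
  | C c => simpa using hasDerivWithinAt_const t s c
  | add p q hp hq => simpa using hp.fun_add hq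
  | mul_X p i hp =>
    have := hp.fun_mul (hX i)
    simp only [map_mul, eval_X, Derivation.leibniz, mkDerivation_X, smul_eq_mul, map_add]
    rw [add_comm, mul_comm (X t i)]
    exact this

theorem abs_sub_taylor_le {X : ℝ → ι → ℝ} {T s : ℝ} (hs : 0 ≤ s)
    (hX : ∀ t ∈ Set.Icc 0 T, ∀ i,
      HasDerivWithinAt (fun u => X u i) (eval (X t) (V i)) (Set.Icc 0 T) t)
    (k : ℕ) (B : ℝ) (p : MvPolynomial ι ℝ)
    (hB : ∀ t ∈ Set.Icc 0 T, |eval (X t) ((mkDerivation ℝ V)^[k] p)| ≤ B)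
    {t : ℝ} (ht : t ∈ Set.Icc s T) :
    |eval (X t) p - ∑ j ∈ Finset.range k,
        (t - s) ^ j / j.factorial * eval (X s) ((mkDerivation ℝ V)^[j] p)|
      ≤ B * (t - s) ^ k / k.factorial := by
  induction k generalizing p t with
  | zero => simpa using hB t ⟨hs.trans ht.1, ht.2⟩
  | succ k ih =>
    have hIH := fun t (ht : t ∈ Set.Icc s T) => ih (mkDerivation ℝ V p) (by simpa using hB) ht
    have hd : ∀ u ∈ Set.Icc s T, HasDerivWithinAt (fun u => eval (X u) p
        - ∑ j ∈ Finset.range (k + 1),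
          (u - s) ^ j / j.factorial * eval (X s) ((mkDerivation ℝ V)^[j] p))
        (eval (X u) (mkDerivation ℝ V p) - ∑ j ∈ Finset.range k,
          (u - s) ^ j / j.factorial * eval (X s) ((mkDerivation ℝ V)^[j] (mkDerivation ℝ V p)))
        (Set.Icc s T) u := by
      intro u hu
      refine ((hasDerivWithinAt_eval (hX u ⟨hs.trans hu.1, hu.2⟩) p).mono
        (Set.Icc_subset_Icc_left hs)).sub ?_
      simp only [Finset.sum_range_succ', pow_zero]
      refine HasDerivWithinAt.add_const _ (HasDerivWithinAt.fun_sum fun j _ => ?_)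
      refine HasDerivWithinAt.mul_const ?_ _
      have := ((((hasDerivAt_id' u).sub_const s).fun_pow (j + 1)).div_const
        ((j + 1).factorial : ℝ)).hasDerivWithinAt (s := Set.Icc s T)
      refine this.congr_deriv ?_
      simp only [Nat.factorial_succ]
      push_cast
      have := Nat.factorial_ne_zero j
      field_simp
    have := image_norm_le_of_norm_deriv_right_le_deriv_boundary
      (fun u hu => (hd u hu).continuousWithinAt)
      (fun u hu => (hd u ⟨hu.1, hu.2.le⟩).mono_of_mem_nhdsWithin
        (Icc_mem_nhdsGE_of_mem hu))
      (B := fun u => B * (u - s) ^ (k + 1) / (k + 1).factorial)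
      (B' := fun u => B * (u - s) ^ k / k.factorial) ?_ ?_
      (fun u hu => hIH u ⟨hu.1, hu.2.le⟩) ht
    · exact this
    · simp [Finset.sum_range_succ']
    · intro u
      have := ((((hasDerivAt_id' u).sub_const s).fun_pow (k + 1)).const_mul B).div_const
        ((k + 1).factorial : ℝ)
      refine this.congr_deriv ?_
      simp only [Nat.factorial_succ]
      push_cast
      have := Nat.factorial_ne_zero k
      field_simp

theorem eval_eq_of_mkDerivation_eq_zero {X : ℝ → ι → ℝ} {T : ℝ}
    (hX : ∀ t ∈ Set.Icc 0 T, ∀ i,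
      HasDerivWithinAt (fun u => X u i) (eval (X t) (V i)) (Set.Icc 0 T) t)
    {p : MvPolynomial ι ℝ} (hp : mkDerivation ℝ V p = 0) {t : ℝ} (ht : t ∈ Set.Icc 0 T) :
    eval (X t) p = eval (X 0) p := by
  have := abs_sub_taylor_le le_rfl hX 1 0 p (by simp [hp]) ht
  simpa [sub_eq_zero] using this

theorem hasLineDerivAt_eval [DecidableEq ι] (p : MvPolynomial ι ℝ) (x : ι → ℝ) (i : ι) :
    HasLineDerivAt ℝ (fun y => eval y p) (eval x (pderiv i p)) x (Pi.single i 1) := by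
  rw [HasLineDerivAt, ← hasDerivWithinAt_univ, pderiv_def]
  have := hasDerivWithinAt_eval (V := Pi.single i 1) (t := 0) (s := Set.univ)
    (X := fun t : ℝ => x + t • Pi.single i 1) (fun j => ?_) p
  · simpa using this
  · rcases eq_or_ne j i with rfl | h
    · simpa using (hasDerivWithinAt_id (0 : ℝ) Set.univ).const_add (x j)
    · simpa [h] using hasDerivWithinAt_const (0 : ℝ) Set.univ (x j)

end Flow

section Measure

variable {ι : Type*} [Fintype ι]

theorem integrable_eval_comp {α : Type*} [MeasurableSpace α] {ν : Measure α} [IsFiniteMeasure ν]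
    {f : α → ι → ℝ} (hf : Measurable f) {R : ℝ} (hR : 1 ≤ R) (hfR : ∀ᵐ x ∂ν, ∀ i, |f x i| ≤ R)
    (p : MvPolynomial ι ℝ) : Integrable (fun x => eval (f x) p) ν := by
  obtain ⟨d, M, hp⟩ := IsPolyBound.exists_bound p
  refine Integrable.of_bound ((continuous_eval p).measurable.comp hf).aestronglyMeasurable
    (M * R ^ d) ?_
  filter_upwards [hfR] with x hx
  exact hp.abs_eval_le hR hx

theorem hasSum_charFunDual {μ : Measure (ι → ℝ)} [IsFiniteMeasure μ] {R : ℝ}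
    (hR : 1 ≤ R) (hμ : ∀ᵐ x ∂μ, ∀ i, |x i| ≤ R) (L : StrongDual ℝ (ι → ℝ))
    {q : MvPolynomial ι ℝ} (hq : ∀ x, eval x q = L x) :
    HasSum (fun n : ℕ => ((n.factorial : ℂ)⁻¹ * Complex.I ^ n) * (∫ x, eval x (q ^ n) ∂μ : ℝ))
      (charFunDual μ L) := by
  rw [charFunDual_apply]
  simp_rw [← integral_complex_ofReal, ← integral_const_mul]
  refine hasSum_integral_of_dominated_convergence
    (fun n _ => (‖L‖ * R) ^ n / n.factorial) (fun n => ?_) (fun n => ?_) ?_ ?_ ?_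
  · refine (Continuous.aestronglyMeasurable ?_)
    have := continuous_eval (q ^ n)
    fun_prop
  · filter_upwards [hμ] with x hx
    have h1 : |L x| ≤ ‖L‖ * R := (L.le_opNorm x).trans (mul_le_mul_of_nonneg_left
      ((pi_norm_le_iff_of_nonneg (zero_le_one.trans hR)).2 hx) (norm_nonneg _))
    simp only [map_pow, hq, norm_mul, norm_inv, norm_pow, Complex.norm_I, one_pow, mul_one,
      Complex.norm_natCast, Complex.norm_real, Real.norm_eq_abs]
    rw [div_eq_inv_mul]
    gcongr
  · exact ae_of_all _ fun _ => Real.summable_pow_div_factorial _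
  · exact integrable_const _
  · refine ae_of_all _ fun x => ?_
    have := NormedSpace.expSeries_div_hasSum_exp (L x * Complex.I : ℂ)
    rw [← Complex.exp_eq_exp_ℂ] at this
    refine this.congr_fun fun n => ?_
    simp only [map_pow, hq]
    push_cast
    rw [mul_pow]
    ring

theorem measure_ext_of_integral_eval_eq {μ ν : Measure (ι → ℝ)} [IsFiniteMeasure μ]
    [IsFiniteMeasure ν] {R : ℝ} (hR : 1 ≤ R) (hμ : ∀ᵐ x ∂μ, ∀ i, |x i| ≤ R)
    (hν : ∀ᵐ x ∂ν, ∀ i, |x i| ≤ R)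
    (h : ∀ p : MvPolynomial ι ℝ, ∫ x, eval x p ∂μ = ∫ x, eval x p ∂ν) : μ = ν := by
  classical
  refine Measure.ext_of_charFunDual (funext fun L => ?_)
  have hq : ∀ x, eval x (∑ i, C (L (Pi.single i 1)) * X i : MvPolynomial ι ℝ) = L x := by
    intro x
    refine Eq.trans ?_ (LinearMap.pi_apply_eq_sum_univ (L : (ι → ℝ) →ₗ[ℝ] ℝ) x).symm
    simp only [map_sum, map_mul, eval_C, eval_X, smul_eq_mul, ContinuousLinearMap.coe_coe]
    refine Finset.sum_congr rfl fun i _ => ?_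
    rw [mul_comm]
    congr 2
    ext j
    simp [Pi.single_apply, eq_comm]
  refine (hasSum_charFunDual hR hμ L hq).unique ?_
  simp_rw [h]
  exact hasSum_charFunDual hR hν L hq

variable {V : ι → MvPolynomial ι ℝ} {K R T : ℝ} {Φ : ℝ → (ι → ℝ) → ι → ℝ}
  {ν : Measure (ι → ℝ)} [IsFiniteMeasure ν]

theorem integral_eval_flow_eq_of_le (hV : ∀ i, IsPolyBound 2 K (V i)) (hK : 0 ≤ K) (hR : 1 ≤ R)
    (hmeas : ∀ t, Measurable (Φ t))
    (hΦ : ∀ x, ∀ t ∈ Set.Icc 0 T, ∀ i,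
      HasDerivWithinAt (fun u => Φ u x i) (eval (Φ t x) (V i)) (Set.Icc 0 T) t)
    (hbdd : ∀ᵐ x ∂ν, ∀ t ∈ Set.Icc 0 T, ∀ i, |Φ t x i| ≤ R)
    (hinv : ∀ p, ∫ x, eval x (mkDerivation ℝ V p) ∂ν = 0)
    {s t : ℝ} (hs : 0 ≤ s) (ht : t ∈ Set.Icc s T) (hst : 2 * K * R * (t - s) ≤ 1 / 2)
    (heq : ∀ p, ∫ x, eval (Φ s x) p ∂ν = ∫ x, eval x p ∂ν) (p : MvPolynomial ι ℝ) :
    ∫ x, eval (Φ t x) p ∂ν = ∫ x, eval x p ∂ν := by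
  obtain ⟨B, hB0, hB⟩ := IsPolyBound.exists_abs_eval_iterate_le hV hK hR p
  have hs' : s ∈ Set.Icc 0 T := ⟨hs, ht.1.trans ht.2⟩
  have ht' : t ∈ Set.Icc 0 T := ⟨hs.trans ht.1, ht.2⟩
  have hint : ∀ u ∈ Set.Icc 0 T, ∀ q, Integrable (fun x => eval (Φ u x) q) ν := fun u hu q =>
    integrable_eval_comp (hmeas u) hR (hbdd.mono fun x hx => hx u hu) q
  have hR0 : 0 ≤ R := zero_le_one.trans hR
  have hts : 0 ≤ t - s := sub_nonneg.2 ht.1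
  have key : ∀ k : ℕ, |∫ x, eval (Φ t x) p ∂ν - ∫ x, eval x p ∂ν|
      ≤ B * (1 / 2) ^ (k + 1) * ν.real Set.univ := by
    intro k
    have hsum : ∫ x, ∑ j ∈ Finset.range (k + 1),
        (t - s) ^ j / j.factorial * eval (Φ s x) ((mkDerivation ℝ V)^[j] p) ∂ν
        = ∫ x, eval x p ∂ν := by
      rw [integral_finsetSum _ fun j _ => (hint s hs' _).const_mul _]
      simp only [integral_const_mul, heq, Finset.sum_range_succ', Function.iterate_succ_apply',
        hinv]
      simp
    rw [← hsum, ← integral_sub (hint t ht' p)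
      (integrable_finsetSum _ fun j _ => (hint s hs' _).const_mul _)]
    rw [← Real.norm_eq_abs]
    refine norm_integral_le_of_norm_le_const ?_
    filter_upwards [hbdd] with x hx
    refine (abs_sub_taylor_le hs (hΦ x) (k + 1) _ p (fun u hu => hB (k + 1) _ (hx u hu))
      ht).trans ?_
    have hf : ((k + 1).factorial : ℝ) ≠ 0 := by exact_mod_cast Nat.factorial_ne_zero _
    calc B * (k + 1).factorial * (2 * K * R) ^ (k + 1) * (t - s) ^ (k + 1) / (k + 1).factorial
        = B * (2 * K * R * (t - s)) ^ (k + 1) := by rw [mul_pow (2 * K * R)]; field_simp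
      _ ≤ _ := by gcongr
  have hlim : Tendsto (fun k : ℕ => B * (1 / 2 : ℝ) ^ (k + 1) * ν.real Set.univ) atTop (𝓝 0) := by
    have := (tendsto_pow_atTop_nhds_zero_of_lt_one (r := (1 / 2 : ℝ)) (by norm_num)
      (by norm_num)).comp (tendsto_add_atTop_nat 1)
    simpa using (this.const_mul B).mul_const (ν.real Set.univ)
  have := ge_of_tendsto' hlim key
  exact sub_eq_zero.1 (abs_nonpos_iff.1 this)

/-- A finite measure which is infinitesimally invariant under a quadratic vector field is
invariant under its flow, as long as almost every trajectory stays in a fixed bounded set. -/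
theorem map_flow_eq_of_integral_mkDerivation_eq_zero (hV : ∀ i, IsPolyBound 2 K (V i))
    (hK : 0 ≤ K) (hR : 1 ≤ R) (hmeas : ∀ t, Measurable (Φ t)) (hΦ0 : ∀ x, Φ 0 x = x)
    (hΦ : ∀ x, ∀ t ∈ Set.Icc 0 T, ∀ i,
      HasDerivWithinAt (fun u => Φ u x i) (eval (Φ t x) (V i)) (Set.Icc 0 T) t)
    (hbdd : ∀ᵐ x ∂ν, ∀ t ∈ Set.Icc 0 T, ∀ i, |Φ t x i| ≤ R)
    (hinv : ∀ p, ∫ x, eval x (mkDerivation ℝ V p) ∂ν = 0) {t : ℝ} (ht : t ∈ Set.Icc 0 T) :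
    ν.map (Φ t) = ν := by
  have hR0 : 0 ≤ R := zero_le_one.trans hR
  set τ : ℝ := 1 / (4 * K * R + 1)
  have hτ : 0 < τ := by positivity
  have hτ' : 2 * K * R * τ ≤ 1 / 2 := by
    rw [mul_one_div, div_le_iff₀ (by positivity)]; linarith
  have key : ∀ n : ℕ, ∀ t ∈ Set.Icc 0 T, t ≤ n * τ → ∀ p,
      ∫ x, eval (Φ t x) p ∂ν = ∫ x, eval x p ∂ν := by
    intro n
    induction n with
    | zero =>
      intro t ht htn p
      have : t = 0 := le_antisymm (by simpa using htn) ht.1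
      simp [this, hΦ0]
    | succ n ih =>
      intro t ht htn
      push_cast at htn
      have hs : max 0 (t - τ) ≤ t := max_le ht.1 (by linarith)
      refine integral_eval_flow_eq_of_le hV hK hR hmeas hΦ hbdd hinv (le_max_left 0 (t - τ))
        ⟨hs, ht.2⟩ (le_trans (mul_le_mul_of_nonneg_left ?_ (by positivity)) hτ')
        (ih _ ⟨le_max_left _ _, hs.trans ht.2⟩ (max_le (by positivity) (by linarith)))
      linarith [le_max_right 0 (t - τ)]
  obtain ⟨n, hn⟩ := exists_nat_ge (t / τ)
  have hbt : ∀ᵐ x ∂ν, ∀ i, |Φ t x i| ≤ R := hbdd.mono fun x hx => hx t ht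
  have hb0 : ∀ᵐ x ∂ν, ∀ i, |x i| ≤ R := hbdd.mono fun x hx => by
    simpa [hΦ0] using hx 0 ⟨le_rfl, ht.1.trans ht.2⟩
  refine measure_ext_of_integral_eval_eq hR ?_ hb0 fun p => ?_
  · refine (ae_map_iff (hmeas t).aemeasurable ?_).2 hbt
    measurability
  · rw [integral_map (hmeas t).aemeasurable (continuous_eval p).aestronglyMeasurable]
    exact key n t ht ((div_le_iff₀ hτ).1 hn) p

end Measure

section Divergence

variable {ι : Type*} [Fintype ι] {V : ι → MvPolynomial ι ℝ}

theorem mkDerivation_apply_eq_sum (V : ι → MvPolynomial ι ℝ) (p : MvPolynomial ι ℝ) :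
    mkDerivation ℝ V p = ∑ i, V i * pderiv i p := by
  classical
  induction p using MvPolynomial.induction_on with
  | C c => simp
  | add p q hp hq => simp only [map_add, hp, hq, mul_add, Finset.sum_add_distrib]
  | mul_X p j hp =>
    simp only [Derivation.leibniz, mkDerivation_X, smul_eq_mul, hp, mul_add,
      Finset.sum_add_distrib, pderiv_X, Pi.single_apply, Finset.mul_sum]
    simp [mul_comm, mul_left_comm]

/-- The squared Euclidean norm as a polynomial. -/
noncomputable def sqNormPoly (ι : Type*) [Fintype ι] : MvPolynomial ι ℝ := ∑ i, X i ^ 2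

theorem eval_sqNormPoly (x : ι → ℝ) : eval x (sqNormPoly ι) = ∑ i, x i ^ 2 := by
  simp [sqNormPoly]

theorem pderiv_sqNormPoly (i : ι) : pderiv i (sqNormPoly ι) = 2 * X i := by
  classical
  simp [sqNormPoly, pderiv_X, Pi.single_apply]

theorem mkDerivation_sqNormPoly (hV : ∑ i, X i * V i = 0) :
    mkDerivation ℝ V (sqNormPoly ι) = 0 := by
  rw [mkDerivation_apply_eq_sum]
  simp_rw [pderiv_sqNormPoly]
  calc ∑ i, V i * (2 * X i) = 2 * ∑ i, X i * V i := by
        rw [Finset.mul_sum]; exact Finset.sum_congr rfl fun i _ => by ring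
    _ = 0 := by rw [hV, mul_zero]

theorem hasCompactSupport_comp_sqNormPoly {φ : ℝ → ℝ} (hφ : HasCompactSupport φ) :
    HasCompactSupport fun x : ι → ℝ => φ (eval x (sqNormPoly ι)) := by
  obtain ⟨M, hM⟩ := hφ.isCompact.isBounded.exists_norm_le
  refine HasCompactSupport.intro (isCompact_closedBall (0 : ι → ℝ) (1 + |M|)) fun x hx => ?_
  by_contra h
  refine hx ?_
  have h1 : ∑ i, x i ^ 2 ≤ |M| := by
    rw [← eval_sqNormPoly]
    exact (le_abs_self _).trans ((hM _ (subset_tsupport _ h)).trans (le_abs_self M))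
  rw [mem_closedBall_zero_iff, pi_norm_le_iff_of_nonneg (by positivity)]
  intro i
  have h2 : x i ^ 2 ≤ |M| :=
    (Finset.single_le_sum (fun j _ => sq_nonneg (x j)) (Finset.mem_univ i)).trans h1
  rw [Real.norm_eq_abs]
  nlinarith [sq_abs (x i), abs_nonneg (x i)]

theorem integral_mul_mkDerivation_eq_zero {φ : ℝ → ℝ} (hφ : ContDiff ℝ 1 φ)
    (hφc : HasCompactSupport φ) (hV : ∑ i, X i * V i = 0) (hdiv : ∑ i, pderiv i (V i) = 0)
    (p : MvPolynomial ι ℝ) :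
    ∫ x : ι → ℝ, φ (eval x (sqNormPoly ι)) * eval x (mkDerivation ℝ V p) = 0 := by
  classical
  have hsq := continuous_eval (sqNormPoly ι)
  have hint : ∀ q : MvPolynomial ι ℝ,
      Integrable fun x : ι → ℝ => eval x q * φ (eval x (sqNormPoly ι)) := fun q =>
    ((continuous_eval q).mul (hφ.continuous.comp hsq)).integrable_of_hasCompactSupport
      (hasCompactSupport_comp_sqNormPoly hφc).mul_left
  have hint' : ∀ q : MvPolynomial ι ℝ,
      Integrable fun x : ι → ℝ => eval x q * deriv φ (eval x (sqNormPoly ι)) := fun q =>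
    ((continuous_eval q).mul
      ((hφ.continuous_deriv le_rfl).comp hsq)).integrable_of_hasCompactSupport
      (hasCompactSupport_comp_sqNormPoly hφc.deriv).mul_left
  have hparts : ∀ i, ∫ x : ι → ℝ, eval x (V i * p * pderiv i (sqNormPoly ι)) *
      deriv φ (eval x (sqNormPoly ι))
      = - ∫ x : ι → ℝ, eval x (pderiv i (V i * p)) * φ (eval x (sqNormPoly ι)) := by
    intro i
    have := integral_bilinear_hasLineDerivAt_right_eq_neg_left_of_integrable
      (μ := (volume : Measure (ι → ℝ))) (B := ContinuousLinearMap.mul ℝ ℝ)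
      (v := Pi.single i 1) (f := fun x => eval x (V i * p))
      (f' := fun x => eval x (pderiv i (V i * p)))
      (g := fun x => φ (eval x (sqNormPoly ι)))
      (g' := fun x => eval x (pderiv i (sqNormPoly ι)) * deriv φ (eval x (sqNormPoly ι)))
      (hint _) ?_ (hint _) (fun x _ => hasLineDerivAt_eval _ x i) ?_
    · simpa only [ContinuousLinearMap.mul_apply', map_mul, mul_assoc] using this
    · simpa [mul_assoc] using hint' (V i * p * pderiv i (sqNormPoly ι))
    · intro x _
      have h1 := hasLineDerivAt_eval (sqNormPoly ι) x i
      rw [HasLineDerivAt] at h1 ⊢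
      have h2 : HasDerivAt φ (deriv φ (eval x (sqNormPoly ι)))
          (eval (x + (0 : ℝ) • Pi.single i 1) (sqNormPoly ι)) := by
        simpa using (hφ.differentiable one_ne_zero _).hasDerivAt
      rw [mul_comm]
      exact h2.comp 0 h1
  have hsum := Finset.sum_congr rfl fun i (_ : i ∈ Finset.univ) => hparts i
  rw [← integral_finsetSum _ fun i _ => hint' _, Finset.sum_neg_distrib,
    ← integral_finsetSum _ fun i _ => hint _] at hsum
  simp only [← Finset.sum_mul, ← map_sum] at hsum
  have h1 : ∑ i, V i * p * pderiv i (sqNormPoly ι) = 0 := by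
    rw [← mul_zero p, ← mkDerivation_sqNormPoly hV, mkDerivation_apply_eq_sum, Finset.mul_sum]
    exact Finset.sum_congr rfl fun i _ => by ring
  have h2 : ∑ i, pderiv i (V i * p) = mkDerivation ℝ V p := by
    simp only [pderiv_mul, Finset.sum_add_distrib, ← Finset.sum_mul, hdiv, zero_mul, zero_add,
      mkDerivation_apply_eq_sum]
  rw [h1, h2] at hsum
  simp only [map_zero, zero_mul, integral_zero] at hsum
  simp_rw [mul_comm (φ _)]
  linarith

variable {K T : ℝ} {Φ : ℝ → (ι → ℝ) → ι → ℝ}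

theorem map_flow_withDensity_eq (hV : ∀ i, IsPolyBound 2 K (V i)) (hK : 0 ≤ K)
    (henergy : ∑ i, X i * V i = 0) (hdiv : ∑ i, pderiv i (V i) = 0)
    (hmeas : ∀ t, Measurable (Φ t)) (hΦ0 : ∀ x, Φ 0 x = x)
    (hΦ : ∀ x, ∀ t ∈ Set.Icc 0 T, ∀ i,
      HasDerivWithinAt (fun u => Φ u x i) (eval (Φ t x) (V i)) (Set.Icc 0 T) t)
    {φ : ℝ → ℝ} (hφ : ContDiff ℝ 1 φ) (hφc : HasCompactSupport φ) (hφ0 : ∀ u, 0 ≤ φ u)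
    {t : ℝ} (ht : t ∈ Set.Icc 0 T) :
    (volume.withDensity fun x => ENNReal.ofReal (φ (∑ i, x i ^ 2))).map (Φ t)
      = volume.withDensity fun x => ENNReal.ofReal (φ (∑ i, x i ^ 2)) := by
  simp_rw [← eval_sqNormPoly]
  have hcont : Continuous fun x : ι → ℝ => φ (eval x (sqNormPoly ι)) :=
    hφ.continuous.comp (continuous_eval _)
  have hcs := hasCompactSupport_comp_sqNormPoly (ι := ι) hφc
  have : IsFiniteMeasure (volume.withDensity fun x : ι → ℝ =>
      ENNReal.ofReal (φ (eval x (sqNormPoly ι)))) :=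
    isFiniteMeasure_withDensity_ofReal (hcont.integrable_of_hasCompactSupport hcs).2
  obtain ⟨M, hM⟩ := hφc.isCompact.isBounded.exists_norm_le
  refine map_flow_eq_of_integral_mkDerivation_eq_zero (R := 1 + |M|) hV hK
    (le_add_of_nonneg_right (abs_nonneg M)) hmeas hΦ0 hΦ ?_ (fun p => ?_) ht
  · refine (ae_withDensity_iff hcont.measurable.ennreal_ofReal).2 (ae_of_all _ fun x hx s hs i => ?_)
    have h0 : φ (eval x (sqNormPoly ι)) ≠ 0 := fun h => hx (by simp [h])
    have h1 : ∑ j, Φ s x j ^ 2 ≤ |M| := by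
      rw [← eval_sqNormPoly, eval_eq_of_mkDerivation_eq_zero (hΦ x)
        (mkDerivation_sqNormPoly henergy) hs, hΦ0]
      exact (le_abs_self _).trans ((hM _ (subset_tsupport _ h0)).trans (le_abs_self M))
    have h2 : Φ s x i ^ 2 ≤ |M| :=
      (Finset.single_le_sum (fun j _ => sq_nonneg (Φ s x j)) (Finset.mem_univ i)).trans h1
    nlinarith [sq_abs (Φ s x i), abs_nonneg (Φ s x i)]
  · rw [integral_withDensity_eq_integral_toReal_smul hcont.measurable.ennreal_ofReal
      (ae_of_all _ fun _ => ENNReal.ofReal_lt_top)]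
    simp_rw [ENNReal.toReal_ofReal (hφ0 _), smul_eq_mul]
    exact integral_mul_mkDerivation_eq_zero hφ hφc henergy hdiv p

/-- The flow of a divergence-free quadratic vector field which preserves the Euclidean norm
preserves every measure with an integrable density that depends smoothly on the norm. -/
theorem map_flow_withDensity_eq_of_lintegral_ne_top (hV : ∀ i, IsPolyBound 2 K (V i))
    (hK : 0 ≤ K) (henergy : ∑ i, X i * V i = 0) (hdiv : ∑ i, pderiv i (V i) = 0)
    (hmeas : ∀ t, Measurable (Φ t)) (hΦ0 : ∀ x, Φ 0 x = x)
    (hΦ : ∀ x, ∀ t ∈ Set.Icc 0 T, ∀ i,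
      HasDerivWithinAt (fun u => Φ u x i) (eval (Φ t x) (V i)) (Set.Icc 0 T) t)
    {φ : ℝ → ℝ} (hφ : ContDiff ℝ 1 φ) (hφ0 : ∀ u, 0 ≤ φ u)
    (hφi : ∫⁻ x : ι → ℝ, ENNReal.ofReal (φ (∑ i, x i ^ 2)) ≠ ⊤)
    {t : ℝ} (ht : t ∈ Set.Icc 0 T) :
    (volume.withDensity fun x => ENNReal.ofReal (φ (∑ i, x i ^ 2))).map (Φ t)
      = volume.withDensity fun x => ENNReal.ofReal (φ (∑ i, x i ^ 2)) := by
  let χ : ℕ → ContDiffBump (0 : ℝ) := fun n => ⟨n + 1, n + 2, by positivity, by linarith⟩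
  have hn : ∀ n, (volume.withDensity fun x =>
      ENNReal.ofReal (φ (∑ i, x i ^ 2) * χ n (∑ i, x i ^ 2))).map (Φ t)
      = volume.withDensity fun x => ENNReal.ofReal (φ (∑ i, x i ^ 2) * χ n (∑ i, x i ^ 2)) :=
    fun n => map_flow_withDensity_eq hV hK henergy hdiv hmeas hΦ0 hΦ (φ := fun u => φ u * χ n u)
      (hφ.mul (χ n).contDiff) (χ n).hasCompactSupport.mul_left
      (fun u => mul_nonneg (hφ0 u) (χ n).nonneg) ht
  have hlim : ∀ s : Set (ι → ℝ), MeasurableSet s → Tendsto (fun n => (volume.withDensity fun x =>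
      ENNReal.ofReal (φ (∑ i, x i ^ 2) * χ n (∑ i, x i ^ 2))) s) atTop
      (𝓝 ((volume.withDensity fun x => ENNReal.ofReal (φ (∑ i, x i ^ 2))) s)) := by
    intro s hs
    simp_rw [withDensity_apply _ hs]
    refine tendsto_lintegral_of_dominated_convergence
      (fun x => ENNReal.ofReal (φ (∑ i, x i ^ 2))) (fun n => ?_) (fun n => ?_) ?_ ?_
    · have := hφ.continuous
      have := (χ n).continuous
      exact Measurable.ennreal_ofReal (by fun_prop)
    · exact ae_of_all _ fun x => ENNReal.ofReal_le_ofReal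
        (mul_le_of_le_one_right (hφ0 _) (χ n).le_one)
    · exact ((lintegral_mono' Measure.restrict_le_self le_rfl).trans_lt hφi.lt_top).ne
    · refine ae_of_all _ fun x => tendsto_const_nhds.congr' ?_
      obtain ⟨m, hm⟩ := exists_nat_ge (∑ i, x i ^ 2)
      filter_upwards [eventually_ge_atTop m] with n hmn
      have hmn' : (m : ℝ) ≤ n := by exact_mod_cast hmn
      rw [(χ n).one_of_mem_closedBall, mul_one]
      rw [mem_closedBall_zero_iff, Real.norm_of_nonneg (Finset.sum_nonneg fun i _ => sq_nonneg _)]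
      change _ ≤ (n : ℝ) + 1
      linarith
  refine Measure.ext fun s hs => ?_
  rw [Measure.map_apply (hmeas t) hs]
  refine tendsto_nhds_unique (hlim _ (hmeas t hs)) ?_
  refine (hlim s hs).congr fun n => ?_
  rw [← Measure.map_apply (hmeas t) hs, hn]

end Divergence

theorem pi_withDensity_ofReal {ι : Type*} [Fintype ι] {g : ℝ → ℝ} (hg : Integrable g)
    (hg0 : ∀ x, 0 ≤ g x) :
    Measure.pi (fun _ : ι => volume.withDensity fun x => ENNReal.ofReal (g x))
      = volume.withDensity fun x : ι → ℝ => ENNReal.ofReal (∏ i, g (x i)) := by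
  have : IsFiniteMeasure (volume.withDensity fun x => ENNReal.ofReal (g x)) :=
    isFiniteMeasure_withDensity_ofReal hg.2
  refine Measure.pi_eq fun s hs => ?_
  rw [withDensity_apply _ (MeasurableSet.univ_pi hs), volume_pi, Measure.restrict_pi_pi,
    ← ofReal_integral_eq_lintegral_ofReal
      (Integrable.fintype_prod fun i => hg.restrict)
      (ae_of_all _ fun x => Finset.prod_nonneg fun i _ => hg0 _),
    integral_fintype_prod_eq_prod (fun _ => g),
    ENNReal.ofReal_prod_of_nonneg fun i _ => integral_nonneg hg0]
  refine Finset.prod_congr rfl fun i _ => ?_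
  rw [withDensity_apply _ (hs i), ofReal_integral_eq_lintegral_ofReal hg.restrict
    (ae_of_all _ hg0)]

section Shell

/-- The conventional components `X_m` of the shell model, as polynomials. -/
noncomputable def shellVar (N m : ℕ) : MvPolynomial (Fin N) ℝ :=
  if h : 1 ≤ m ∧ m ≤ N then X ⟨m - 1, by omega⟩ else 0

/-- The `n`-th component of the vector field of the shell model. -/
noncomputable def shellField (lam : ℝ) (N n : ℕ) : MvPolynomial (Fin N) ℝ :=
  C (shellK lam N n) * shellVar N (n - 1) ^ 2
    - C (shellK lam N (n + 1)) * shellVar N n * shellVar N (n + 1)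
    - C (shellK lam N n) * shellVar N (n + 1) ^ 2
    + C (shellK lam N (n - 1)) * shellVar N (n - 1) * shellVar N n

variable {lam : ℝ} {N : ℕ}

theorem eval_shellVar (v : Fin N → ℝ) (m : ℕ) : eval v (shellVar N m) = extendFin N v m := by
  unfold shellVar extendFin
  split_ifs <;> simp

theorem shellVar_succ (i : Fin N) : shellVar N (i + 1) = X i := by
  have : (i : ℕ) + 1 ≤ N := i.2
  simp [shellVar, this]

theorem extendFin_succ (v : Fin N → ℝ) (i : Fin N) : extendFin N v (i + 1) = v i := by
  rw [← eval_shellVar, shellVar_succ, eval_X]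

theorem pderiv_shellVar_of_ne {i : Fin N} {m : ℕ} (h : m ≠ i + 1) :
    pderiv i (shellVar N m) = 0 := by
  unfold shellVar
  split_ifs with hm
  · refine pderiv_X_of_ne fun h' => h ?_
    rw [← h']
    change m = m - 1 + 1
    omega
  · exact map_zero _

theorem shellK_eq_zero {n : ℕ} (h : ¬(1 < n ∧ n < N)) : shellK lam N n = 0 := if_neg h

theorem abs_shellK_le (hlam : 1 < lam) (n : ℕ) : |shellK lam N n| ≤ lam ^ N := by
  have h0 : 0 ≤ lam := by linarith
  unfold shellK
  split_ifs with h
  · rw [abs_of_nonneg (by positivity)]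
    exact pow_le_pow_right₀ hlam.le h.2.le
  · simpa using pow_nonneg h0 N

theorem isPolyBound_shellField (hlam : 1 < lam) (n : ℕ) :
    IsPolyBound 2 (4 * lam ^ N) (shellField lam N n) := by
  have hvar : ∀ m, IsPolyBound 1 1 (shellVar N m) := fun m => by
    unfold shellVar
    split_ifs
    · exact IsPolyBound.of_X _
    · exact IsPolyBound.mono (IsPolyBound.zero 1) le_rfl zero_le_one
  have hterm : ∀ n a b, IsPolyBound 2 (lam ^ N)
      (C (shellK lam N n) * (shellVar N a * shellVar N b)) := fun n a b =>
    IsPolyBound.mono (((hvar a).mul (hvar b)).C_mul _) le_rfl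
      (by simpa using abs_shellK_le hlam n)
  unfold shellField
  simp only [pow_two, mul_assoc]
  exact IsPolyBound.mono ((((hterm _ _ _).sub (hterm _ _ _)).sub (hterm _ _ _)).add
    (hterm _ _ _)) le_rfl (by linarith)

theorem sum_X_mul_shellField (lam : ℝ) (N : ℕ) :
    ∑ i : Fin N, X i * shellField lam N (i + 1) = 0 := by
  let f : ℕ → MvPolynomial (Fin N) ℝ := fun n =>
    C (shellK lam N n) * (shellVar N (n - 1) ^ 2 * shellVar N n)
      + C (shellK lam N (n - 1)) * (shellVar N (n - 1) * shellVar N n ^ 2)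
  have h : ∀ i : Fin N, X i * shellField lam N (i + 1) = f (i + 1) - f (i + 1 + 1) := by
    intro i
    simp only [f, ← shellVar_succ i, shellField, Nat.add_sub_cancel]
    ring
  rw [Finset.sum_congr rfl fun i _ => h i,
    Fin.sum_univ_eq_sum_range (fun i => f (i + 1) - f (i + 1 + 1)),
    Finset.sum_range_sub' fun i => f (i + 1)]
  simp [f, shellK_eq_zero]

theorem sum_pderiv_shellField (lam : ℝ) (N : ℕ) :
    ∑ i : Fin N, pderiv i (shellField lam N (i + 1)) = 0 := by
  let g : ℕ → MvPolynomial (Fin N) ℝ := fun m => C (shellK lam N m) * shellVar N m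
  have h : ∀ i : Fin N, pderiv i (shellField lam N (i + 1))
      = (g i + g (i + 1)) - (g (i + 1) + g (i + 1 + 1)) := by
    intro i
    have h1 : pderiv i (shellVar N i) = 0 := pderiv_shellVar_of_ne (by omega)
    have h2 : pderiv i (shellVar N (i + 1 + 1)) = 0 := pderiv_shellVar_of_ne (by omega)
    have h3 : pderiv i (shellVar N (i + 1)) = 1 := by rw [shellVar_succ, pderiv_X_self]
    simp only [shellField, g, Nat.add_sub_cancel, map_add, map_sub, pderiv_mul, pderiv_pow,
      pderiv_C, h1, h2, h3]
    ring
  rw [Finset.sum_congr rfl fun i _ => h i,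
    Fin.sum_univ_eq_sum_range (fun i => (g i + g (i + 1)) - (g (i + 1) + g (i + 1 + 1))),
    Finset.sum_range_sub' fun i => g i + g (i + 1)]
  simp [g, shellK_eq_zero]

end Shell

theorem pi_gaussianReal_eq_withDensity {ι : Type*} [Fintype ι] {v : NNReal} (hv : v ≠ 0) :
    Measure.pi (fun _ : ι => gaussianReal 0 v) = volume.withDensity fun x : ι → ℝ =>
      ENNReal.ofReal ((Real.sqrt (2 * Real.pi * v))⁻¹ ^ Fintype.card ι *
        Real.exp (-(∑ i, x i ^ 2) / (2 * v))) := by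
  rw [gaussianReal_of_var_ne_zero 0 hv]
  refine (pi_withDensity_ofReal (integrable_gaussianPDFReal 0 v)
    (gaussianPDFReal_nonneg 0 v)).trans ?_
  congr 1
  funext x
  simp only [gaussianPDFReal, sub_zero, Finset.prod_mul_distrib, Finset.prod_const,
    Finset.card_univ, ← Real.exp_sum, ← Finset.sum_div, Finset.sum_neg_distrib]

end Helpers

/-- if `Φ_t` is the solution flow of the `N`-dimensional shell model on `[0,T]`,
then for every `r > 0` the product Gaussian measure `μ_r^N = ⊗_{n=1}^N N(0,r²)` is invariant:
the pushforward of `μ_r^N` by `x ↦ Φ_t(x)` equals `μ_r^N` for every `t ∈ [0,T]`. -/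
theorem shell_gaussian_invariant (lam T : ℝ) (hlam : 1 < lam) (hT : 0 < T)
    (N : ℕ) (hN : 1 ≤ N)
    (Φ : ℝ → (Fin N → ℝ) → (Fin N → ℝ))
    (hΦmeas : ∀ t : ℝ, Measurable (Φ t))
    (hΦsol : ∀ x : Fin N → ℝ,
      Φ 0 x = x ∧ IsShellSolution lam N T (fun t => extendFin N (Φ t x)))
    (r : ℝ) (hr : 0 < r) :
    ∀ t ∈ Set.Icc (0 : ℝ) T,
      Measure.map (Φ t) (Measure.pi fun _ : Fin N => gaussianReal 0 (r ^ 2).toNNReal)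
        = Measure.pi fun _ : Fin N => gaussianReal 0 (r ^ 2).toNNReal := by
  intro t ht
  have hv : (r ^ 2).toNNReal ≠ 0 := by
    rw [Ne, Real.toNNReal_eq_zero, not_le]; positivity
  have hlam0 : 0 ≤ lam := by linarith
  have hfin : ∫⁻ x : Fin N → ℝ, ENNReal.ofReal
      ((Real.sqrt (2 * Real.pi * (r ^ 2).toNNReal))⁻¹ ^ Fintype.card (Fin N) *
        Real.exp (-(∑ i, x i ^ 2) / (2 * (r ^ 2).toNNReal))) ≠ ⊤ := by
    rw [← setLIntegral_univ, ← withDensity_apply _ MeasurableSet.univ,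
      ← pi_gaussianReal_eq_withDensity hv]
    exact measure_ne_top _ _
  rw [pi_gaussianReal_eq_withDensity hv]
  refine map_flow_withDensity_eq_of_lintegral_ne_top
    (V := fun i : Fin N => shellField lam N (i + 1)) (T := T)
    (φ := fun u => (Real.sqrt (2 * Real.pi * (r ^ 2).toNNReal))⁻¹ ^ Fintype.card (Fin N) *
      Real.exp (-u / (2 * (r ^ 2).toNNReal)))
    (fun i => isPolyBound_shellField hlam _) (by positivity) (sum_X_mul_shellField lam N)
    (sum_pderiv_shellField lam N) hΦmeas (fun x => (hΦsol x).1) (fun x s hs i => ?_)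
    (by fun_prop) (fun u => by positivity) hfin ht
  have := (hΦsol x).2.2.2 (i + 1) (by omega) i.2 s hs
  simp only [extendFin_succ] at this
  refine this.congr_deriv ?_
  simp [shellField, eval_shellVar, extendFin_succ]
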